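/- Let p be a lattice norm on ℝ² with p((1,0)) = 1 that is strictly increasing on the vertical half-line {(1,u) : u ≥ 0} (i.e. 0 ≤ u < v implies p((1,u)) < p((1,v))), and let Φ be a strictly convex Orlicz function. Assume that for every x ∈ L^Φ(μ) with x ≠ 0 there exists l ∈ (0,∞) with ‖x‖_{Φ,p} = (1/l)·p((1, I_Φ(lx))). Then (L^Φ(μ), ‖·‖_{Φ,p}) is strictly convex: for all x, y ∈ L^Φ(μ) with ‖x‖_{Φ,p} = ‖y‖_{Φ,p} = 1 and x ≠ y, one has ‖(x+y)/2‖_{Φ,p} < 1. -/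

import Mathlib

open MeasureTheory Filter

noncomputable section

/-- The Orlicz modular `I_Φ(x) = ∫ Φ(x t) dμ` (valued in `[0,∞]`). -/
def Iphi {Ω : Type*} [MeasurableSpace Ω] (μ : Measure Ω) (Φ : ℝ → ℝ) (x : Ω → ℝ) : ENNReal :=
  ∫⁻ t, ENNReal.ofReal (Φ (x t)) ∂μ

/-- One term `(1/k)·p((1, I_Φ(kx)))` of the defining infimum; value `∞` if `I_Φ(kx) = ∞`. -/
def aTerm {Ω : Type*} [MeasurableSpace Ω] (μ : Measure Ω) (Φ : ℝ → ℝ) (p : ℝ × ℝ → ℝ)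
    (x : Ω → ℝ) (k : ℝ) : ENNReal :=
  if Iphi μ Φ (fun t => k * x t) = ⊤ then ⊤
  else ENNReal.ofReal ((1 / k) * p (1, (Iphi μ Φ (fun t => k * x t)).toReal))

/-- The norm `‖x‖_{Φ,p} = inf_{k>0} (1/k)·p((1, I_Φ(kx)))`. -/
def aNorm {Ω : Type*} [MeasurableSpace Ω] (μ : Measure Ω) (Φ : ℝ → ℝ) (p : ℝ × ℝ → ℝ)
    (x : Ω → ℝ) : ENNReal :=
  ⨅ (k : ℝ) (_ : 0 < k), aTerm μ Φ p x k

/-- `Φ` is an Orlicz function: convex, even, vanishing at `0`, nonnegative, not identically `0`. -/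
def IsOrlicz (Φ : ℝ → ℝ) : Prop :=
  ConvexOn ℝ Set.univ Φ ∧ (∀ u, Φ (-u) = Φ u) ∧ Φ 0 = 0 ∧ (∀ u, 0 ≤ Φ u) ∧ ∃ u, Φ u ≠ 0

/-- `p` is a lattice norm on `ℝ²`: a norm which is monotone with respect to the
coordinatewise order on absolute values. -/
def IsLatticeNorm (p : ℝ × ℝ → ℝ) : Prop :=
  (∀ a b : ℝ × ℝ, p (a + b) ≤ p a + p b) ∧ (∀ (c : ℝ) (a : ℝ × ℝ), p (c • a) = |c| * p a) ∧
  (∀ a : ℝ × ℝ, p a = 0 → a = 0) ∧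
  (∀ a b : ℝ × ℝ, |a.1| ≤ |b.1| → |a.2| ≤ |b.2| → p a ≤ p b)

/-- `p` is strictly monotone: `0 ≤ a ≤ b` coordinatewise and `a ≠ b` imply `p a < p b`. -/
def StrictMonoNorm (p : ℝ × ℝ → ℝ) : Prop :=
  ∀ a b : ℝ × ℝ, 0 ≤ a.1 → 0 ≤ a.2 → a.1 ≤ b.1 → a.2 ≤ b.2 → a ≠ b → p a < p b

/-- Membership in the Orlicz space `L^Φ(μ)`. -/
def MemLphi {Ω : Type*} [MeasurableSpace Ω] (μ : Measure Ω) (Φ : ℝ → ℝ) (x : Ω → ℝ) : Prop :=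
  Measurable x ∧ ∃ l : ℝ, 0 < l ∧ Iphi μ Φ (fun t => l * x t) ≠ ⊤

/-- Membership in the space `E^Φ(μ)` of order continuous elements. -/
def MemEphi {Ω : Type*} [MeasurableSpace Ω] (μ : Measure Ω) (Φ : ℝ → ℝ) (x : Ω → ℝ) : Prop :=
  Measurable x ∧ ∀ l : ℝ, 0 < l → Iphi μ Φ (fun t => l * x t) ≠ ⊤

/-- `a(Φ) = sup{u ≥ 0 : Φ(u) = 0}`. -/
def aPhi (Φ : ℝ → ℝ) : ℝ := sSup {u : ℝ | 0 ≤ u ∧ Φ u = 0}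

/-- `K(x) = {k > 0 : ‖x‖_{Φ,p} = (1/k)·p((1, I_Φ(kx)))}`. -/
def Kset {Ω : Type*} [MeasurableSpace Ω] (μ : Measure Ω) (Φ : ℝ → ℝ) (p : ℝ × ℝ → ℝ)
    (x : Ω → ℝ) : Set ℝ :=
  {k : ℝ | 0 < k ∧ aNorm μ Φ p x = aTerm μ Φ p x k}

/-- Condition `Δ₂(ℝ₊)`: `Φ(2u) ≤ K·Φ(u)` for all `u ≥ 0`. -/
def Delta2 (Φ : ℝ → ℝ) : Prop := ∃ K : ℝ, 0 < K ∧ ∀ u : ℝ, 0 ≤ u → Φ (2 * u) ≤ K * Φ u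

/-- A non-atomic measure: every set of positive measure has a measurable subset of
strictly smaller positive measure. -/
def NonAtomic {Ω : Type*} [MeasurableSpace Ω] (μ : Measure Ω) : Prop :=
  ∀ A : Set Ω, MeasurableSet A → 0 < μ A →
    ∃ B ⊆ A, MeasurableSet B ∧ 0 < μ B ∧ μ B < μ A

/-- The modulus of monotonicity of `(ℝ², p)`:
`δ_{m,p}(ε) = inf{1 − p(b − a) : 0 ≤ a ≤ b coordinatewise, p a ≥ ε, p b = 1}`. -/
def deltaM (p : ℝ × ℝ → ℝ) (ε : ℝ) : ℝ :=
  sInf {d : ℝ | ∃ a b : ℝ × ℝ, 0 ≤ a.1 ∧ 0 ≤ a.2 ∧ a.1 ≤ b.1 ∧ a.2 ≤ b.2 ∧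
    ε ≤ p a ∧ p b = 1 ∧ d = 1 - p (b - a)}

/-- A convex function on `ℝ` that is strictly convex at midpoints is strictly convex. -/
theorem ConvexOn.strictConvexOn_of_midpoint_lt {Φ : ℝ → ℝ} (hc : ConvexOn ℝ Set.univ Φ)
    (hsc : ∀ u v : ℝ, u ≠ v → Φ ((u + v) / 2) < (Φ u + Φ v) / 2) :
    StrictConvexOn ℝ Set.univ Φ := by
  have key : ∀ u v a b : ℝ, u ≠ v → 0 < a → a ≤ b → a + b = 1 →
      Φ (a * u + b * v) < a * Φ u + b * Φ v := by
    intro u v a b huv ha hab h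
    have h1 := hc.2 (Set.mem_univ ((u + v) / 2)) (Set.mem_univ v)
      (by linarith : 0 ≤ 2 * a) (by linarith : 0 ≤ b - a) (by linarith)
    simp only [smul_eq_mul] at h1
    have h2 : 2 * a * ((u + v) / 2) + (b - a) * v = a * u + b * v := by ring
    rw [h2] at h1
    nlinarith [mul_lt_mul_of_pos_left (hsc u v huv) ha]
  refine ⟨convex_univ, fun u _ v _ huv a b ha hb hab => ?_⟩
  simp only [smul_eq_mul]
  rcases le_total a b with h | h
  · exact key u v a b huv ha h hab
  · rw [add_comm (a * u), add_comm (a * Φ u)]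
    exact key v u b a huv.symm hb h (by linarith)

theorem IsOrlicz.continuous {Φ : ℝ → ℝ} (hΦ : IsOrlicz Φ) : Continuous Φ :=
  continuousOn_univ.1 (hΦ.1.continuousOn isOpen_univ)

/-- The section `u ↦ p (1, u)` of a lattice norm is convex. -/
theorem IsLatticeNorm.convexOn_right {p : ℝ × ℝ → ℝ} (hp : IsLatticeNorm p) :
    ConvexOn ℝ Set.univ (fun u => p (1, u)) := by
  refine ⟨convex_univ, fun u _ v _ a b ha hb hab => ?_⟩
  have h := hp.1 (a • (1, u)) (b • (1, v))
  rw [hp.2.1, hp.2.1, abs_of_nonneg ha, abs_of_nonneg hb] at h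
  simpa [hab] using h

/-- Strict convexity of the modular between functions of finite modular. -/
theorem Iphi_convexComb_lt {Ω : Type*} [MeasurableSpace Ω] {μ : Measure Ω} {Φ : ℝ → ℝ}
    (hΦ : IsOrlicz Φ) (hsc : StrictConvexOn ℝ Set.univ Φ) {f g : Ω → ℝ} (hf : Measurable f)
    (hg : Measurable g) (hfI : Iphi μ Φ f ≠ ⊤) (hgI : Iphi μ Φ g ≠ ⊤) (hfg : ¬ f =ᵐ[μ] g)
    {a b : ℝ} (ha : 0 < a) (hb : 0 < b) (hab : a + b = 1) :
    Iphi μ Φ (fun t => a * f t + b * g t) <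
      ENNReal.ofReal a * Iphi μ Φ f + ENNReal.ofReal b * Iphi μ Φ g := by
  have hm := hΦ.continuous.measurable
  have hnn := hΦ.2.2.2.1
  have hfm : Measurable fun t => ENNReal.ofReal (Φ (f t)) := (hm.comp hf).ennreal_ofReal
  have hgm : Measurable fun t => ENNReal.ofReal (Φ (g t)) := (hm.comp hg).ennreal_ofReal
  have hsum : ENNReal.ofReal a * Iphi μ Φ f + ENNReal.ofReal b * Iphi μ Φ g =
      ∫⁻ t, ENNReal.ofReal (a * Φ (f t) + b * Φ (g t)) ∂μ := by
    rw [Iphi, Iphi, ← lintegral_const_mul _ hfm, ← lintegral_const_mul _ hgm,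
      ← lintegral_add_left (hfm.const_mul _)]
    refine lintegral_congr fun t => ?_
    rw [ENNReal.ofReal_add (mul_nonneg ha.le (hnn _)) (mul_nonneg hb.le (hnn _)),
      ENNReal.ofReal_mul ha.le, ENNReal.ofReal_mul hb.le]
  have hle : ∀ t, Φ (a * f t + b * g t) ≤ a * Φ (f t) + b * Φ (g t) := fun t => by
    simpa using hΦ.1.2 (Set.mem_univ (f t)) (Set.mem_univ (g t)) ha.le hb.le hab
  have hfin : ENNReal.ofReal a * Iphi μ Φ f + ENNReal.ofReal b * Iphi μ Φ g ≠ ⊤ := by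
    finiteness
  have hle' : ∀ᵐ t ∂μ, ENNReal.ofReal (Φ (a * f t + b * g t)) ≤
      ENNReal.ofReal (a * Φ (f t) + b * Φ (g t)) :=
    ae_of_all _ fun t => ENNReal.ofReal_le_ofReal (hle t)
  rw [hsum] at hfin ⊢
  refine lintegral_strict_mono_of_ae_le_of_frequently_ae_lt
    (by fun_prop) ((lintegral_mono_ae hle').trans_lt hfin.lt_top).ne hle' ?_
  refine (show ∃ᵐ t ∂μ, f t ≠ g t from hfg ∘ fun h => ?_).mono fun t ht => ?_
  · filter_upwards [h] with t ht using not_not.1 ht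
  · have hlt := hsc.2 (Set.mem_univ (f t)) (Set.mem_univ (g t)) ht ha hb hab
    simp only [smul_eq_mul] at hlt
    exact ((ENNReal.ofReal_lt_ofReal_iff ((hnn _).trans_lt hlt)).2 hlt).ne

theorem aTerm_eq_one_iff {Ω : Type*} [MeasurableSpace Ω] {μ : Measure Ω} {Φ : ℝ → ℝ}
    {p : ℝ × ℝ → ℝ} {x : Ω → ℝ} {k : ℝ} (hk : 0 < k) :
    aTerm μ Φ p x k = 1 ↔ Iphi μ Φ (fun t => k * x t) ≠ ⊤ ∧
      p (1, (Iphi μ Φ (fun t => k * x t)).toReal) = k := by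
  unfold aTerm
  split_ifs with h
  · simp [h]
  · rw [ENNReal.ofReal_eq_one, one_div, inv_mul_eq_one₀ hk.ne', eq_comm]
    simp [h]

theorem aNorm_lt_one_of_ae_eq_zero {Ω : Type*} [MeasurableSpace Ω] {μ : Measure Ω} {Φ : ℝ → ℝ}
    {p : ℝ × ℝ → ℝ} (hΦ0 : Φ 0 = 0) (h10 : p (1, 0) = 1) {x : Ω → ℝ} (hx : x =ᵐ[μ] 0) :
    aNorm μ Φ p x < 1 := by
  refine (iInf₂_le (2 : ℝ) two_pos).trans_lt ?_
  have h0 : Iphi μ Φ (fun t => 2 * x t) = 0 := by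
    rw [Iphi, lintegral_congr_ae (g := fun _ => 0), lintegral_zero]
    filter_upwards [hx] with t ht
    simp [ht, hΦ0]
  rw [aTerm, h0, if_neg ENNReal.zero_ne_top, ENNReal.toReal_zero, h10, ENNReal.ofReal_lt_one]
  norm_num

/-- If `p` is a lattice norm on `ℝ²` with `p (1,0) = 1` which is strictly increasing on the
vertical half-line `{(1,u) : u ≥ 0}`, `Φ` is a strictly convex Orlicz function, and the
defining infimum of `‖·‖_{Φ,p}` is attained for every nonzero `x ∈ L^Φ(μ)`, then
`(L^Φ(μ), ‖·‖_{Φ,p})` is strictly convex. -/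
theorem stmt6 {Ω : Type*} [MeasurableSpace Ω] (μ : Measure Ω) [SigmaFinite μ]
    (Φ : ℝ → ℝ) (hΦ : IsOrlicz Φ)
    (hsc : ∀ u v : ℝ, u ≠ v → Φ ((u + v) / 2) < (Φ u + Φ v) / 2)
    (p : ℝ × ℝ → ℝ) (hp : IsLatticeNorm p) (h10 : p (1, 0) = 1)
    (hpinc : ∀ u v : ℝ, 0 ≤ u → u < v → p (1, u) < p (1, v))
    (hatt : ∀ x : Ω → ℝ, MemLphi μ Φ x → ¬ x =ᵐ[μ] 0 →
      ∃ l : ℝ, 0 < l ∧ aNorm μ Φ p x = aTerm μ Φ p x l)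
    (x y : Ω → ℝ) (hx : MemLphi μ Φ x) (hy : MemLphi μ Φ y)
    (hnx : aNorm μ Φ p x = 1) (hny : aNorm μ Φ p y = 1) (hxy : ¬ x =ᵐ[μ] y) :
    aNorm μ Φ p (fun t => (x t + y t) / 2) < 1 := by
  have hx0 : ¬ x =ᵐ[μ] 0 := fun h => (aNorm_lt_one_of_ae_eq_zero hΦ.2.2.1 h10 h).ne hnx
  have hy0 : ¬ y =ᵐ[μ] 0 := fun h => (aNorm_lt_one_of_ae_eq_zero hΦ.2.2.1 h10 h).ne hny
  obtain ⟨l, hl, hlx⟩ := hatt x hx hx0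
  obtain ⟨m, hm, hmy⟩ := hatt y hy hy0
  obtain ⟨hIx, hpx⟩ := (aTerm_eq_one_iff hl).1 (hlx.symm.trans hnx)
  obtain ⟨hIy, hpy⟩ := (aTerm_eq_one_iff hm).1 (hmy.symm.trans hny)
  have hne : ¬ (fun t => l * x t) =ᵐ[μ] fun t => m * y t := by
    intro h
    have hI : Iphi μ Φ (fun t => l * x t) = Iphi μ Φ (fun t => m * y t) :=
      lintegral_congr_ae (h.mono fun t ht => by simp only [ht])
    have hlm : l = m := by rw [← hpx, hI, hpy]
    refine hxy (h.mono fun t ht => ?_)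
    simp only [← hlm] at ht
    exact mul_left_cancel₀ hl.ne' ht
  have hs : 0 < l + m := add_pos hl hm
  have ha : 0 < m / (l + m) := div_pos hm hs
  have hb : 0 < l / (l + m) := div_pos hl hs
  have hab : m / (l + m) + l / (l + m) = 1 := by field_simp; ring
  have hlt := Iphi_convexComb_lt hΦ (hΦ.1.strictConvexOn_of_midpoint_lt hsc)
    (hx.1.const_mul l) (hy.1.const_mul m) hIx hIy hne ha hb hab
  have hz : (fun t => m / (l + m) * (l * x t) + l / (l + m) * (m * y t)) =
      fun t => 2 * l * m / (l + m) * ((x t + y t) / 2) := by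
    funext t
    field_simp
  rw [hz] at hlt
  have hk : 0 < 2 * l * m / (l + m) := by positivity
  refine (iInf₂_le _ hk).trans_lt ?_
  have hlt' := (ENNReal.toReal_lt_toReal hlt.ne_top (by finiteness)).2 hlt
  rw [ENNReal.toReal_add (by finiteness) (by finiteness), ENNReal.toReal_mul, ENNReal.toReal_mul,
    ENNReal.toReal_ofReal ha.le, ENNReal.toReal_ofReal hb.le] at hlt'
  have hconv := hp.convexOn_right.2 (Set.mem_univ (Iphi μ Φ (fun t => l * x t)).toReal)
    (Set.mem_univ (Iphi μ Φ (fun t => m * y t)).toReal) ha.le hb.le hab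
  simp only [smul_eq_mul, hpx, hpy] at hconv
  rw [aTerm, if_neg hlt.ne_top, ENNReal.ofReal_lt_one, one_div, inv_mul_lt_one₀ hk]
  calc _ < _ := hpinc _ _ ENNReal.toReal_nonneg hlt'
    _ ≤ _ := hconv
    _ = _ := by ring
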